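/- Let p, q ≥ 1 and let Ω be a proper quasi-homogeneous domain of Ein^{p,q}. Then there exist nonzero proper linear subspaces V₀, V₁ ⊆ ℝⁿ such that ℝⁿ = V₀ ⊕ V₁, B(v₀, v₁) = 0 for all v₀ ∈ V₀ and v₁ ∈ V₁, the restrictions of B to V₀ and to V₁ are nondegenerate, and every g ∈ Conf(Ω) satisfies g(V₀) = V₀ and g(V₁) = V₁. -/

import Mathlib

noncomputable section

open scoped LinearAlgebra.Projectivization ENNReal
open Projectivization Filter Topology Set

variable {W : Type} [AddCommGroup W] [Module ℝ W] [TopologicalSpace W]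

instance projTopology : TopologicalSpace (ℙ ℝ W) :=
  inferInstanceAs (TopologicalSpace (Quotient (projectivizationSetoid ℝ W)))

/-- The null cone in projective space determined by a quadratic form `v ↦ Bf v v`. -/
def einSet (Bf : W → W → ℝ) : Set (ℙ ℝ W) := {x | Bf x.rep x.rep = 0}

/-- The lightcone of a point of the Einstein universe. -/
def lightcone (Bf : W → W → ℝ) (x : ℙ ℝ W) : Set (ℙ ℝ W) :=
  {y | y ∈ einSet Bf ∧ Bf x.rep y.rep = 0}

/-- A domain: nonempty connected open subset of the Einstein universe
(open and connected in the subspace topology of `einSet Bf`). -/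
def IsEinDomain (Bf : W → W → ℝ) (Ω : Set (ℙ ℝ W)) : Prop :=
  Ω ⊆ einSet Bf ∧
  IsOpen (Subtype.val ⁻¹' Ω : Set (einSet Bf)) ∧
  IsConnected (Subtype.val ⁻¹' Ω : Set (einSet Bf))

/-- A proper domain: some lightcone misses the closure. -/
def IsProperDomain (Bf : W → W → ℝ) (Ω : Set (ℙ ℝ W)) : Prop :=
  IsEinDomain Bf Ω ∧ ∃ x ∈ einSet Bf, closure Ω ∩ lightcone Bf x = ∅

/-- The projective transformation induced by a linear automorphism. -/
def projMap (g : W ≃ₗ[ℝ] W) : ℙ ℝ W → ℙ ℝ W :=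
  Projectivization.map (g : W →ₗ[ℝ] W) g.injective

/-- The conformal group of a domain. -/
def Conf (Bf : W → W → ℝ) (Ω : Set (ℙ ℝ W)) : Set (W ≃ₗ[ℝ] W) :=
  {g | (∀ v, Bf (g v) (g v) = Bf v v) ∧ projMap g '' Ω = Ω}

/-- Quasi-homogeneity of a domain. -/
def IsQuasiHomogeneous (Bf : W → W → ℝ) (Ω : Set (ℙ ℝ W)) : Prop :=
  ∃ K : Set (ℙ ℝ W), K ⊆ Ω ∧ IsCompact K ∧
    Ω = ⋃ g ∈ Conf Bf Ω, projMap g '' K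

/-- Dual convexity: every frontier point admits a supporting lightcone. -/
def IsDuallyConvex (Bf : W → W → ℝ) (Ω : Set (ℙ ℝ W)) : Prop :=
  ∀ a ∈ closure Ω \ Ω, ∃ b ∈ einSet Bf, a ∈ lightcone Bf b ∧ lightcone Bf b ∩ Ω = ∅

/-- The hyperbolic distance on the interval `(-1,1)`. -/
def dHyp (s t : ℝ) : ℝ := |Real.log (((1 + t) * (1 - s)) / ((1 - t) * (1 + s)))|

/-- The interval of parameters. -/
def II : Set ℝ := Set.Ioo (-1 : ℝ) 1

/-- A projectively parametrized lightlike geodesic with values in `Ω`. -/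
def IsLightGeodesic (Bf : W → W → ℝ) (Ω : Set (ℙ ℝ W)) (α : ℝ → ℙ ℝ W) : Prop :=
  ∃ (u w : W) (a b c d : ℝ),
    LinearIndependent ℝ ![u, w] ∧
    Bf u u = 0 ∧ Bf u w = 0 ∧ Bf w w = 0 ∧
    a * d - b * c ≠ 0 ∧
    ∀ t ∈ II, ∃ h : (a * t + b) • u + (c * t + d) • w ≠ 0,
      α t = Projectivization.mk ℝ ((a * t + b) • u + (c * t + d) • w) h ∧ α t ∈ Ω

/-- `IsChainCost Bf Ω x y N c` : there is a chain of index `N` from `x` to `y` in `Ω`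
whose cost is `c`. -/
def IsChainCost (Bf : W → W → ℝ) (Ω : Set (ℙ ℝ W)) (x y : ℙ ℝ W) (N : ℕ) (c : ℝ) : Prop :=
  ∃ (xs : Fin (N + 1) → ℙ ℝ W) (αs : Fin N → ℝ → ℙ ℝ W) (ss ts : Fin N → ℝ),
    xs 0 = x ∧ xs (Fin.last N) = y ∧
    (∀ i : Fin N, IsLightGeodesic Bf Ω (αs i) ∧ ss i ∈ II ∧ ts i ∈ II ∧
      αs i (ss i) = xs i.castSucc ∧ αs i (ts i) = xs i.succ) ∧
    c = ∑ i : Fin N, dHyp (ss i) (ts i)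

/-- The Markowitz pseudodistance of `Ω`, with values in `[0,∞]`. -/
def markowitz (Bf : W → W → ℝ) (Ω : Set (ℙ ℝ W)) (x y : ℙ ℝ W) : ℝ≥0∞ :=
  sInf {e | ∃ (N : ℕ) (c : ℝ), 1 ≤ N ∧ IsChainCost Bf Ω x y N c ∧ e = ENNReal.ofReal c}

/-- The Markowitz pseudodistance restricted to chains of index at most `Nmax`. -/
def markowitzN (Bf : W → W → ℝ) (Ω : Set (ℙ ℝ W)) (Nmax : ℕ) (x y : ℙ ℝ W) : ℝ≥0∞ :=
  sInf {e | ∃ (N : ℕ) (c : ℝ), 1 ≤ N ∧ N ≤ Nmax ∧ IsChainCost Bf Ω x y N c ∧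
    e = ENNReal.ofReal c}

/-- The projectivization of a linear subspace. -/
def projSet (Pl : Submodule ℝ W) : Set (ℙ ℝ W) := {y | y.rep ∈ Pl}

/-- A photon subspace: a totally isotropic plane. -/
def IsPhotonSub (Bf : W → W → ℝ) (Pl : Submodule ℝ W) : Prop :=
  Module.finrank ℝ Pl = 2 ∧ ∀ u ∈ Pl, ∀ w ∈ Pl, Bf u w = 0

/-- Photon-extremal points of the frontier of `Ω`. -/
def IsPhotonExtremal (Bf : W → W → ℝ) (Ω : Set (ℙ ℝ W)) (a : ℙ ℝ W) : Prop :=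
  a ∈ closure Ω \ Ω ∧
  ∀ Pl : Submodule ℝ W, IsPhotonSub Bf Pl → a.rep ∈ Pl →
    ¬ ∃ U : Set (ℙ ℝ W), IsOpen U ∧ a ∈ U ∧ U ∩ projSet Pl ⊆ closure Ω

/-- A maximal projectively parametrized lightlike geodesic in `Ω`: its image is
a connected component of `ℙ(Pl) ∩ Ω`. -/
def IsMaxLightGeodesic (Bf : W → W → ℝ) (Ω : Set (ℙ ℝ W)) (α : ℝ → ℙ ℝ W) : Prop :=
  ∃ (u w : W) (a b c d : ℝ),
    LinearIndependent ℝ ![u, w] ∧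
    Bf u u = 0 ∧ Bf u w = 0 ∧ Bf w w = 0 ∧
    a * d - b * c ≠ 0 ∧
    (∀ t ∈ II, ∃ h : (a * t + b) • u + (c * t + d) • w ≠ 0,
      α t = Projectivization.mk ℝ ((a * t + b) • u + (c * t + d) • w) h ∧ α t ∈ Ω) ∧
    α '' II = connectedComponentIn (projSet (Submodule.span ℝ {u, w}) ∩ Ω) (α 0)

/-- The coordinate bilinear form of signature `(p+1, q+1)` on `ℝⁿ`, `n = p+q+2`. -/
def bForm (p q : ℕ) (v w : Fin (p + q + 2) → ℝ) : ℝ :=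
  ∑ i : Fin (p + q + 2), (if (i : ℕ) ≤ p then (-1 : ℝ) else 1) * v i * w i

set_option linter.unusedSectionVars false

theorem isCompact_convexHull_fd {E : Type} [NormedAddCommGroup E] [NormedSpace ℝ E]
    [FiniteDimensional ℝ E] {s : Set E} (hs : IsCompact s) : IsCompact (convexHull ℝ s) := by
  have key : convexHull ℝ s = ⋃ m ∈ Iic (Module.finrank ℝ E + 1),
      (fun q : (Fin m → ℝ) × (Fin m → E) => ∑ i, q.1 i • q.2 i) ''
        (stdSimplex ℝ (Fin m) ×ˢ Set.pi univ (fun _ => s)) := by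
    apply Subset.antisymm
    · intro x hx
      obtain ⟨ι, _, z, w, hz, hai, hw, hw1, hsum⟩ := eq_pos_convex_span_of_mem_convexHull hx
      have hcard : Fintype.card ι ≤ Module.finrank ℝ E + 1 :=
        hai.card_le_finrank_succ.trans (by
          have := Submodule.finrank_le (vectorSpan ℝ (Set.range z))
          omega)
      let e := Fintype.equivFin ι
      refine mem_biUnion hcard ⟨(w ∘ e.symm, z ∘ e.symm), ⟨⟨fun i => (hw _).le, ?_⟩, ?_⟩, ?_⟩
      · rw [← hw1]; exact e.symm.sum_comp w
      · intro i _; exact hz ⟨_, rfl⟩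
      · rw [← hsum]; exact e.symm.sum_comp (fun i => w i • z i)
    · refine iUnion₂_subset fun m _ => ?_
      rintro _ ⟨⟨w, z⟩, ⟨hw, hz⟩, rfl⟩
      exact (convex_convexHull ℝ s).sum_mem (fun i _ => hw.1 i) hw.2
        (fun i _ => subset_convexHull ℝ s (hz i trivial))
  rw [key]
  refine (finite_Iic _).isCompact_biUnion fun m _ => ?_
  exact ((isCompact_stdSimplex ℝ (Fin m)).prod (isCompact_univ_pi fun _ => hs)).image (by fun_prop)

/-- Data of a null cone `S` with a cocompact isometry group `G`. -/
structure GoodCone {E : Type} [NormedAddCommGroup E] [NormedSpace ℝ E]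
    (B : E →ₗ[ℝ] E →ₗ[ℝ] ℝ) (S : Set E) (u : E) (c : ℝ) (G : Set (E ≃ₗ[ℝ] E)) (K : Set E) :
    Prop where
  symm : ∀ v w, B v w = B w v
  nondeg : ∀ v, (∀ w, B v w = 0) → v = 0
  perp : ∀ x, ∃ w₁ w₂, B x w₁ = 0 ∧ 0 < B w₁ w₁ ∧ B x w₂ = 0 ∧ B w₂ w₂ < 0
  nonempty : S.Nonempty
  smul : ∀ t : ℝ, 0 < t → ∀ v ∈ S, t • v ∈ S
  relopen : ∀ x ∈ S, ∀ᶠ y in 𝓝 x, B y y = 0 → y ∈ S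
  null : ∀ v ∈ S, B v v = 0
  unull : B u u = 0
  cpos : 0 < c
  bound : ∀ v ∈ S, c * ‖v‖ ≤ B u v
  ne_zero : ∀ v ∈ S, v ≠ 0
  isom : ∀ g ∈ G, ∀ v w, B (g v) (g w) = B v w
  pres : ∀ g ∈ G, ∀ v, g v ∈ S ↔ v ∈ S
  compact : IsCompact K
  sub : K ⊆ S
  cover : ∀ y ∈ S, ∃ g ∈ G, ∃ x ∈ K, ∃ t : ℝ, 0 < t ∧ y = t • g x

namespace GoodCone

variable {E : Type} [NormedAddCommGroup E] [NormedSpace ℝ E] [FiniteDimensional ℝ E]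
    {B : E →ₗ[ℝ] E →ₗ[ℝ] ℝ} {S : Set E} {u : E} {c : ℝ} {G : Set (E ≃ₗ[ℝ] E)} {K : Set E}

theorem upos (h : GoodCone B S u c G K) {v : E} (hv : v ∈ S) : 0 < B u v :=
  lt_of_lt_of_le (mul_pos h.cpos (norm_pos_iff.2 (h.ne_zero v hv))) (h.bound v hv)

/-- Nearby null vectors along a direction orthogonal to `x`. -/
theorem curve (h : GoodCone B S u c G K) {x w : E} (hx : x ∈ S) (hw : B x w = 0) :
    ∀ᶠ t : ℝ in 𝓝 0, 0 < B u x + t * B u w ∧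
      x + t • w - (t ^ 2 * B w w / (2 * (B u x + t * B u w))) • u ∈ S := by
  have hpos := h.upos hx
  have h1 : ∀ᶠ t : ℝ in 𝓝 0, 0 < B u x + t * B u w := by
    have : ContinuousAt (fun t : ℝ => B u x + t * B u w) 0 := by fun_prop
    exact this.eventually (lt_mem_nhds (by simpa using hpos))
  have h2 : ContinuousAt (fun t : ℝ =>
      x + t • w - (t ^ 2 * B w w / (2 * (B u x + t * B u w))) • u) 0 := by
    have : (2 * (B u x + 0 * B u w)) ≠ 0 := by simpa using hpos.ne'
    fun_prop (disch := assumption)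
  have h3 := h2.eventually (p := fun y => B y y = 0 → y ∈ S) (by simpa using h.relopen x hx)
  filter_upwards [h1, h3] with t ht1 ht3
  refine ⟨ht1, ht3 ?_⟩
  have e1 := h.null x hx
  have e2 := h.unull
  have e3 := h.symm w x
  have e4 := h.symm x u
  have e5 := h.symm w u
  simp only [map_add, map_sub, map_smul, LinearMap.add_apply, LinearMap.sub_apply,
    LinearMap.smul_apply, smul_eq_mul, e1, e2, e3, e4, e5, hw]
  field_simp
  ring

theorem functional (h : GoodCone B S u c G K) {x : E} (hx : x ∈ S) (f : E →ₗ[ℝ] ℝ)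
    (hf : ∀ y ∈ S, 0 ≤ f y) (hfx : f x = 0) : f = 0 := by
  have hpos := h.upos hx
  have key : ∀ w, B x w = 0 → 0 ≤ f w := by
    intro w hw
    have hc := h.curve hx hw
    have h2 : Tendsto (fun t : ℝ => f w - (t * B w w / (2 * (B u x + t * B u w))) * f u) (𝓝[>] 0)
        (𝓝 (f w)) := by
      have : ContinuousAt (fun t : ℝ =>
          f w - (t * B w w / (2 * (B u x + t * B u w))) * f u) 0 := by
        have : (2 * (B u x + 0 * B u w)) ≠ 0 := by simpa using hpos.ne'
        fun_prop (disch := assumption)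
      have h3 := this.tendsto
      simp only [zero_mul, zero_div, sub_zero] at h3
      exact h3.mono_left nhdsWithin_le_nhds
    refine ge_of_tendsto h2 ?_
    filter_upwards [hc.filter_mono nhdsWithin_le_nhds, self_mem_nhdsWithin] with t ht ht0
    have ht0 : 0 < t := ht0
    have := hf _ ht.2
    simp only [map_add, map_sub, map_smul, smul_eq_mul, hfx] at this
    have e : 0 + t * f w - t ^ 2 * B w w / (2 * (B u x + t * B u w)) * f u =
      t * (f w - (t * B w w / (2 * (B u x + t * B u w))) * f u) := by ring
    rw [e] at this
    exact nonneg_of_mul_nonneg_right this ht0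
  have key0 : ∀ w, B x w = 0 → f w = 0 := by
    intro w hw
    have h1 := key w hw
    have h2 := key (-w) (by simp [hw])
    simp only [map_neg] at h2
    linarith
  have key2 : ∀ w, B x w = 0 → B w w * f u ≤ 0 := by
    intro w hw
    have hc := h.curve hx hw
    obtain ⟨t, ht, ht0⟩ := ((hc.filter_mono nhdsWithin_le_nhds).and
      (self_mem_nhdsWithin (s := Ioi (0:ℝ)))).exists
    have ht0 : 0 < t := ht0
    have := hf _ ht.2
    simp only [map_add, map_sub, map_smul, smul_eq_mul, hfx, key0 w hw] at this
    have hp : 0 < t ^ 2 / (2 * (B u x + t * B u w)) := by have := ht.1; positivity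
    have e : 0 + t * 0 - t ^ 2 * B w w / (2 * (B u x + t * B u w)) * f u =
      (t ^ 2 / (2 * (B u x + t * B u w))) * (- (B w w * f u)) := by ring
    rw [e] at this
    have := nonneg_of_mul_nonneg_right this hp
    linarith
  have fu : f u = 0 := by
    obtain ⟨w₁, w₂, a1, a2, a3, a4⟩ := h.perp x
    have b1 := key2 w₁ a1
    have b2 := key2 w₂ a3
    nlinarith
  ext v
  have := key0 (v - (B x v / B u x) • u) (by
    simp only [map_sub, map_smul, smul_eq_mul, h.symm x u]
    field_simp
    ring)
  simpa [fu] using this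

theorem span_top (h : GoodCone B S u c G K) (V : Submodule ℝ E) (hV : S ⊆ V) : V = ⊤ := by
  by_contra hne
  obtain ⟨f, hf0, hf⟩ := V.exists_le_ker_of_lt_top (lt_top_iff_ne_top.2 hne)
  obtain ⟨x, hx⟩ := h.nonempty
  have hz : ∀ y ∈ S, f y = 0 := fun y hy => hf (hV hy)
  exact hf0 (h.functional hx f (fun y hy => (hz y hy).ge) (hz x hx))

theorem interior_mem (h : GoodCone B S u c G K) {x : E} (hx : x ∈ S) :
    x ∈ interior (convexHull ℝ S) := by
  have hconv : Convex ℝ (convexHull ℝ S) := convex_convexHull ℝ S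
  have hinter : (interior (convexHull ℝ S)).Nonempty := by
    rw [hconv.interior_nonempty_iff_affineSpan_eq_top, affineSpan_convexHull,
      AffineSubspace.affineSpan_eq_top_iff_vectorSpan_eq_top_of_nonempty ℝ E E h.nonempty]
    apply h.span_top
    intro y hy
    have := vsub_mem_vectorSpan ℝ (h.smul 2 two_pos y hy) hy
    simpa [two_smul] using this
  by_contra hni
  obtain ⟨f, hf⟩ := geometric_hahn_banach_open_point hconv.interior isOpen_interior hni
  have hle : ∀ y ∈ S, f y ≤ f x := by
    intro y hy
    have hy' : y ∈ closure (interior (convexHull ℝ S)) := by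
      rw [hconv.closure_interior_eq_closure_of_nonempty_interior hinter]
      exact subset_closure (subset_convexHull ℝ S hy)
    exact closure_minimal (t := {y | f y ≤ f x}) (fun a ha => (hf a ha).le)
      (isClosed_le f.continuous continuous_const) hy'
  have h0 : f x = 0 := by
    have h1 := hle _ (h.smul 2 two_pos x hx)
    have h2 := hle _ (h.smul (1/2) (by norm_num) x hx)
    simp only [map_smul, smul_eq_mul] at h1 h2
    linarith
  have hneg := h.functional hx (-(f : E →ₗ[ℝ] ℝ)) (fun y hy => by
    have := hle y hy
    simp; linarith) (by simp [h0])
  obtain ⟨z, hz⟩ := hinter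
  have := hf z hz
  have h5 := LinearMap.congr_fun hneg z
  simp at h5
  linarith


/-- The slice of the cone. -/
def slice (B : E →ₗ[ℝ] E →ₗ[ℝ] ℝ) (S : Set E) (u : E) : Set E := {v | v ∈ S ∧ B u v = 1}

theorem mem_slice (h : GoodCone B S u c G K) {v : E} (hv : v ∈ S) :
    (B u v)⁻¹ • v ∈ slice B S u := by
  have := h.upos hv
  refine ⟨h.smul _ (inv_pos.2 this) v hv, ?_⟩
  simp [this.ne']

theorem closure_bound (h : GoodCone B S u c G K) {v : E} (hv : v ∈ closure S) :
    c * ‖v‖ ≤ B u v :=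
  closure_minimal (t := {v | c * ‖v‖ ≤ B u v}) (fun a ha => h.bound a ha)
    (isClosed_le (by fun_prop) (LinearMap.continuous_of_finiteDimensional (B u))) hv

theorem slice_one {X : Set E} (hX : X = convexHull ℝ (closure (slice B S u))) {v : E}
    (hv : v ∈ X) : B u v = 1 := by
  have hcont : Continuous (B u) := LinearMap.continuous_of_finiteDimensional (B u)
  rw [hX] at hv
  refine convexHull_min (t := {v | B u v = 1}) ?_ ?_ hv
  · exact closure_minimal (fun a ha => ha.2) (isClosed_eq hcont continuous_const)
  · exact convex_hyperplane (B u).isLinear 1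

theorem slice_compact (h : GoodCone B S u c G K) :
    IsCompact (convexHull ℝ (closure (slice B S u))) := by
  apply isCompact_convexHull_fd
  apply Metric.isCompact_of_isClosed_isBounded isClosed_closure
  apply Bornology.IsBounded.closure
  rw [isBounded_iff_forall_norm_le]
  refine ⟨1 / c, fun v hv => ?_⟩
  have := h.bound v hv.1
  rw [hv.2] at this
  rw [le_div_iff₀ h.cpos]
  linarith

theorem closure_cone (h : GoodCone B S u c G K) {v : E} (hv : v ∈ closure S) :
    ∃ t : ℝ, 0 ≤ t ∧ ∃ x ∈ convexHull ℝ (closure (slice B S u)), v = t • x := by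
  have hcont : Continuous (B u) := LinearMap.continuous_of_finiteDimensional (B u)
  by_cases h0 : v = 0
  · obtain ⟨x, hx⟩ := h.nonempty
    exact ⟨0, le_rfl, _, subset_convexHull ℝ _ (subset_closure (h.mem_slice hx)), by simp [h0]⟩
  · have hp : 0 < B u v := lt_of_lt_of_le (mul_pos h.cpos (norm_pos_iff.2 h0)) (h.closure_bound hv)
    refine ⟨B u v, hp.le, (B u v)⁻¹ • v, subset_convexHull ℝ _ ?_, by simp [smul_smul, hp.ne']⟩
    have hca : ContinuousAt (fun v => (B u v)⁻¹ • v) v :=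
      (hcont.continuousAt.inv₀ hp.ne').smul continuousAt_id
    exact hca.continuousWithinAt.mem_closure hv (fun y hy => h.mem_slice hy)

theorem cone_convex {X : Set E} (hX : Convex ℝ X) :
    Convex ℝ {v | ∃ t : ℝ, 0 ≤ t ∧ ∃ x ∈ X, v = t • x} := by
  rintro _ ⟨t, ht, x, hx, rfl⟩ _ ⟨s, hs, y, hy, rfl⟩ a b ha hb hab
  by_cases h0 : a * t + b * s = 0
  · have h1 : 0 ≤ a * t := by positivity
    have h2 : 0 ≤ b * s := by positivity
    have h3 : a * t = 0 := by linarith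
    have h4 : b * s = 0 := by linarith
    exact ⟨0, le_rfl, x, hx, by simp [smul_smul, h3, h4]⟩
  · have hpos : 0 < a * t + b * s := lt_of_le_of_ne (by positivity) (Ne.symm h0)
    refine ⟨a * t + b * s, hpos.le, (a * t / (a * t + b * s)) • x + (b * s / (a * t + b * s)) • y,
      hX hx hy (by positivity) (by positivity) (by field_simp), ?_⟩
    rw [smul_add, smul_smul, smul_smul, smul_smul, smul_smul]
    congr 2 <;> field_simp

/-- A linear map `T` sending `S` to its closure and `x ∈ S` to a multiple of an extreme
point has rank at most one. -/
theorem rank_one (h : GoodCone B S u c G K) {x a : E} (hx : x ∈ S)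
    (ha : a ∈ (convexHull ℝ (closure (slice B S u))).extremePoints ℝ)
    (T : E →ₗ[ℝ] E) (hT : ∀ v ∈ S, T v ∈ closure S) {l : ℝ} (hTx : T x = l • a) (v : E) :
    ∃ m : ℝ, T v = m • a := by
  set X := convexHull ℝ (closure (slice B S u)) with hX
  set N := {v | ∃ t : ℝ, 0 ≤ t ∧ ∃ x ∈ X, v = t • x} with hN
  have hNc : Convex ℝ N := cone_convex (convex_convexHull ℝ _)
  have hTN : ∀ v ∈ convexHull ℝ S, T v ∈ N := by
    intro v hv
    refine convexHull_min (t := T ⁻¹' N) (fun y hy => h.closure_cone (hT y hy)) ?_ hv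
    exact hNc.linear_preimage T
  have hinter := h.interior_mem hx
  rw [mem_interior_iff_mem_nhds] at hinter
  have hca : ∀ s : ℝ, ∀ᶠ t : ℝ in 𝓝 0, x + (s * t) • v ∈ convexHull ℝ S := by
    intro s
    have : ContinuousAt (fun t : ℝ => x + (s * t) • v) 0 := by fun_prop
    exact this.eventually (by simpa using hinter)
  obtain ⟨t, ⟨h1, h2⟩, ht⟩ := (((hca 1).and (hca (-1))).filter_mono
    (nhdsWithin_le_nhds (s := Ioi 0))).and (self_mem_nhdsWithin (s := Ioi (0:ℝ))) |>.exists
  have ht : 0 < t := ht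
  obtain ⟨r, hr, y, hy, e1⟩ := hTN _ h1
  obtain ⟨s, hs, z, hz, e2⟩ := hTN _ h2
  have hsum : r • y + s • z = (2 * l) • a := by
    rw [← e1, ← e2, ← map_add, mul_smul 2 l a, ← hTx, ← map_smul]
    congr 1
    module
  have ha1 : B u a = 1 := slice_one hX ha.1
  have hrs : r + s = 2 * l := by
    have := congrArg (B u) hsum
    simpa [slice_one hX hy, slice_one hX hz, ha1] using this
  have hmul : ∃ m : ℝ, r • y = m • a := by
    rcases hr.eq_or_lt with hr0 | hr0
    · exact ⟨0, by simp [← hr0]⟩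
    rcases hs.eq_or_lt with hs0 | hs0
    · exact ⟨2 * l, by rw [← hsum, ← hs0]; simp⟩
    have hl : 0 < 2 * l := by linarith
    have := (mem_extremePoints.1 ha).2 y hy z hz
      ⟨r / (2 * l), s / (2 * l), by positivity, by positivity, by
        rw [← add_div, hrs]; exact div_self hl.ne', by
        rw [div_eq_inv_mul, div_eq_inv_mul, mul_smul, mul_smul, ← smul_add, hsum, smul_smul,
          inv_mul_cancel₀ hl.ne', one_smul]⟩
    exact ⟨r, by rw [this.1]⟩
  obtain ⟨m, hm⟩ := hmul
  rw [hm, map_add, hTx, map_smul, one_mul] at e1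
  refine ⟨t⁻¹ * (m - l), ?_⟩
  have : t • T v = (m - l) • a := by rw [sub_smul, ← e1]; abel
  rw [mul_smul, ← this, smul_smul, inv_mul_cancel₀ ht.ne', one_smul]

theorem extreme_sign (h : GoodCone B S u c G K) {a : E}
    (ha : a ∈ (convexHull ℝ (closure (slice B S u))).extremePoints ℝ) :
    (∀ y ∈ S, 0 ≤ B a y) ∨ (∀ y ∈ S, B a y ≤ 0) := by
  have hcont : ∀ v, Continuous (B v) := fun v => LinearMap.continuous_of_finiteDimensional (B v)
  have ha1 : B u a = 1 := slice_one rfl ha.1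
  have hacl := extremePoints_convexHull_subset ha
  obtain ⟨y, hy, hya⟩ := mem_closure_iff_seq_limit.1 hacl
  choose g hg x hx t ht hyt using fun k => h.cover (y k) (hy k).1
  -- normalised operators
  let A : ℕ → E →L[ℝ] E := fun k => LinearMap.toContinuousLinearMap (g k : E →ₗ[ℝ] E)
  have hAapp : ∀ k v, A k v = g k v := fun k v => rfl
  have hA0 : ∀ k, 0 < ‖A k‖ := by
    intro k
    rw [norm_pos_iff]
    intro h0
    have : A k (x k) = 0 := by rw [h0]; simp
    rw [hAapp, LinearEquiv.map_eq_zero_iff] at this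
    exact h.ne_zero _ (h.sub (hx k)) this
  let T' : ℕ → E →L[ℝ] E := fun k => ‖A k‖⁻¹ • A k
  have hT'n : ∀ k, T' k ∈ Metric.sphere (0 : E →L[ℝ] E) 1 := by
    intro k
    simp [T', norm_smul, (hA0 k).ne']
  have : ProperSpace (E →L[ℝ] E) := FiniteDimensional.proper ℝ _
  have hcomp : IsCompact (Metric.sphere (0 : E →L[ℝ] E) 1 ×ˢ K) :=
    (isCompact_sphere _ _).prod h.compact
  obtain ⟨⟨T, x₀⟩, ⟨hTn, hx₀⟩, φ, hφ, hlim⟩ :=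
    hcomp.tendsto_subseq (x := fun k => (T' k, x k)) (fun k => ⟨hT'n k, hx k⟩)
  have hlimT : Tendsto (fun k => T' (φ k)) atTop (𝓝 T) :=
    (continuous_fst.tendsto _).comp hlim
  have hlimx : Tendsto (fun k => x (φ k)) atTop (𝓝 x₀) :=
    (continuous_snd.tendsto _).comp hlim
  have hTv : ∀ v, Tendsto (fun k => T' (φ k) v) atTop (𝓝 (T v)) := fun v =>
    ((ContinuousLinearMap.apply ℝ E v).continuous.tendsto T).comp hlimT
  have hT'S : ∀ k, ∀ v ∈ S, T' k v ∈ S := by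
    intro k v hv
    have : T' k v = ‖A k‖⁻¹ • g k v := rfl
    rw [this]
    exact h.smul _ (inv_pos.2 (hA0 k)) _ ((h.pres _ (hg k) v).2 hv)
  have hTS : ∀ v ∈ S, T v ∈ closure S := fun v hv =>
    mem_closure_of_tendsto (hTv v) (Eventually.of_forall fun k => hT'S _ v hv)
  have hTx : Tendsto (fun k => T' (φ k) (x (φ k))) atTop (𝓝 (T x₀)) := by
    have : Continuous (fun q : (E →L[ℝ] E) × E => q.1 q.2) := by fun_prop
    exact (this.tendsto (T, x₀)).comp hlim
  have hTxa : T x₀ = (B u (T x₀)) • a := by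
    have e : ∀ k, T' k (x k) = (B u (T' k (x k))) • y k := by
      intro k
      have e1 : T' k (x k) = (‖A k‖⁻¹ * (t k)⁻¹) • y k := by
        have : T' k (x k) = ‖A k‖⁻¹ • g k (x k) := rfl
        rw [this, hyt k, smul_smul, mul_assoc, inv_mul_cancel₀ (ht k).ne', mul_one]
      have e2 : B u (T' k (x k)) = ‖A k‖⁻¹ * (t k)⁻¹ := by
        rw [e1, map_smul, (hy k).2, smul_eq_mul, mul_one]
      rw [e2]
      exact e1
    have l1 : Tendsto (fun k => (B u (T' (φ k) (x (φ k)))) • y (φ k)) atTop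
        (𝓝 ((B u (T x₀)) • a)) :=
      (((hcont u).tendsto _).comp hTx).smul (hya.comp hφ.tendsto_atTop)
    refine tendsto_nhds_unique hTx (l1.congr fun k => (e _).symm)
  have hr1 := h.rank_one (h.sub hx₀) ha (T : E →ₗ[ℝ] E) hTS hTxa
  -- positivity of `B (T u') y` for `u'` near `u`
  have hT0 : T ≠ 0 := by
    intro h0
    rw [h0] at hTn
    simp at hTn
  have hu' : ∀ᶠ u' in 𝓝 u, ∀ v ∈ S, 0 ≤ B u' v := by
    have hB : Continuous (fun v => (LinearMap.toContinuousLinearMap (B v) : E →L[ℝ] ℝ)) :=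
      LinearMap.continuous_of_finiteDimensional
        ((LinearMap.toContinuousLinearMap (𝕜 := ℝ) (E := E) (F' := ℝ)).toLinearMap ∘ₗ B)
    have h1 : ∀ᶠ u' in 𝓝 u, dist (LinearMap.toContinuousLinearMap (B u') : E →L[ℝ] ℝ)
        (LinearMap.toContinuousLinearMap (B u)) < c :=
      hB.continuousAt.eventually (Metric.ball_mem_nhds _ h.cpos)
    filter_upwards [h1] with u' hu v hv
    have h2 := h.bound v hv
    rw [dist_eq_norm] at hu
    have h3 := ContinuousLinearMap.le_opNorm ((LinearMap.toContinuousLinearMap (B u') : E →L[ℝ] ℝ) -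
      (LinearMap.toContinuousLinearMap (B u))) v
    have h4 : ‖B u' v - B u v‖ ≤ c * ‖v‖ :=
      le_trans h3 (mul_le_mul_of_nonneg_right hu.le (norm_nonneg v))
    have h5 := neg_abs_le (B u' v - B u v)
    rw [Real.norm_eq_abs] at h4
    linarith
  have hex : ∃ u', (∀ v ∈ S, 0 ≤ B u' v) ∧ T u' ≠ 0 := by
    by_contra hno
    push Not at hno
    obtain ⟨v, hv⟩ : ∃ v, T v ≠ 0 := by
      by_contra hall
      push Not at hall
      exact hT0 (ContinuousLinearMap.ext hall)
    have hTu := hno u (hu'.self_of_nhds)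
    have hcc : ContinuousAt (fun s : ℝ => u + s • v) 0 := by fun_prop
    have hev := hcc.eventually (p := fun u' => ∀ v ∈ S, 0 ≤ B u' v) (by simpa using hu')
    obtain ⟨s, h1, hs⟩ := ((hev.filter_mono (nhdsWithin_le_nhds (s := Ioi 0))).and
      (self_mem_nhdsWithin (s := Ioi (0:ℝ)))).exists
    have hs : 0 < s := hs
    have := hno _ h1
    rw [map_add, hTu, map_smul, zero_add, smul_eq_zero] at this
    exact this.elim hs.ne' hv
  obtain ⟨u', hu'S, hTu'⟩ := hex
  have hnn : ∀ z ∈ S, 0 ≤ B (T u') z := by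
    intro z hz
    rw [h.symm]
    refine ge_of_tendsto (((hcont z).tendsto _).comp (hTv u')) (Eventually.of_forall fun k => ?_)
    have e : T' (φ k) u' = ‖A (φ k)‖⁻¹ • g (φ k) u' := rfl
    have hz' : (g (φ k)).symm z ∈ S := by
      rw [← h.pres _ (hg (φ k))]; simpa using hz
    have e2 := h.isom _ (hg (φ k)) u' ((g (φ k)).symm z)
    rw [LinearEquiv.apply_symm_apply] at e2
    simp only [Function.comp_apply, e, map_smul, smul_eq_mul]
    rw [h.symm, e2]
    exact mul_nonneg (inv_nonneg.2 (norm_nonneg _)) (hu'S _ hz')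
  obtain ⟨m, hm⟩ := hr1 u'
  have hm' : T u' = m • a := hm
  rw [hm'] at hnn hTu'
  have hm0 : m ≠ 0 := by rintro rfl; simp at hTu'
  rcases lt_or_gt_of_ne hm0 with hneg | hpos
  · right
    intro z hz
    have := hnn z hz
    simp only [map_smul, LinearMap.smul_apply, smul_eq_mul] at this
    nlinarith
  · left
    intro z hz
    have := hnn z hz
    simp only [map_smul, LinearMap.smul_apply, smul_eq_mul] at this
    exact nonneg_of_mul_nonneg_right this hpos

theorem sign_change (h : GoodCone B S u c G K) (s : ℝ) (hs : s ≠ 0)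
    (hall : ∀ a ∈ (convexHull ℝ (closure (slice B S u))).extremePoints ℝ, ∀ y ∈ S,
      0 ≤ s * B a y) : False := by
  obtain ⟨x, hx⟩ := h.nonempty
  have hX : ∀ a ∈ convexHull ℝ (closure (slice B S u)), ∀ y ∈ S, 0 ≤ s * B a y := by
    intro a ha y hy
    rw [← closure_convexHull_extremePoints h.slice_compact (convex_convexHull ℝ _)] at ha
    let f : E →ₗ[ℝ] ℝ := s • B y
    have hf : Continuous f := LinearMap.continuous_of_finiteDimensional f
    have hfa : ∀ a, f a = s * B a y := fun a => by simp [f, h.symm y a]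
    rw [← hfa]
    refine closure_minimal (t := {a | 0 ≤ f a}) (convexHull_min ?_ ?_)
      (isClosed_le continuous_const hf) ha
    · intro b hb
      show 0 ≤ f b
      rw [hfa]
      exact hall b hb y hy
    · exact convex_halfSpace_ge f.isLinear 0
  have hp := h.upos hx
  have h1 := hX _ (subset_convexHull ℝ _ (subset_closure (h.mem_slice hx)))
  have h2 := h.functional hx (s • B x) (fun y hy => by
    have := h1 y hy
    simp only [map_smul, LinearMap.smul_apply, smul_eq_mul] at this
    rw [mul_left_comm] at this
    exact nonneg_of_mul_nonneg_right this (inv_pos.2 hp)) (by simp [h.null x hx])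
  refine h.ne_zero x hx (h.nondeg x fun w => ?_)
  have := LinearMap.congr_fun h2 w
  simpa [hs] using this

theorem main (h : GoodCone B S u c G K) :
    ∃ V₀ V₁ : Submodule ℝ E,
      V₀ ≠ ⊥ ∧ V₁ ≠ ⊥ ∧ V₀ ≠ ⊤ ∧ V₁ ≠ ⊤ ∧ IsCompl V₀ V₁ ∧
      (∀ v₀ ∈ V₀, ∀ v₁ ∈ V₁, B v₀ v₁ = 0) ∧
      (∀ v ∈ V₀, (∀ w ∈ V₀, B v w = 0) → v = 0) ∧
      (∀ v ∈ V₁, (∀ w ∈ V₁, B v w = 0) → v = 0) ∧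
      ∀ g ∈ G, Submodule.map (g : E →ₗ[ℝ] E) V₀ = V₀ ∧ Submodule.map (g : E →ₗ[ℝ] E) V₁ = V₁ := by
  have hcont : ∀ v, Continuous (B v) := fun v => LinearMap.continuous_of_finiteDimensional (B v)
  let D : ℝ → Set E := fun s => {a | a ∈ closure S ∧ ∀ y ∈ S, 0 ≤ s * B a y}
  have hDcl : ∀ s, ∀ a ∈ D s, ∀ y ∈ closure S, 0 ≤ s * B a y := by
    intro s a ha y hy
    exact closure_minimal (t := {y | 0 ≤ s * B a y}) ha.2
      (isClosed_le continuous_const (continuous_const.mul (hcont a))) hy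
  have hDort : ∀ a ∈ D 1, ∀ b ∈ D (-1), B a b = 0 := by
    intro a ha b hb
    have h1 := hDcl _ a ha b hb.1
    have h2 := hDcl _ b hb a ha.1
    rw [h.symm b a] at h2
    linarith
  have hext : ∀ a ∈ (convexHull ℝ (closure (slice B S u))).extremePoints ℝ,
      a ∈ D 1 ∨ a ∈ D (-1) := by
    intro a ha
    have hcl : a ∈ closure S :=
      closure_mono (fun v hv => hv.1) (extremePoints_convexHull_subset ha)
    rcases h.extreme_sign ha with h1 | h1
    · left; exact ⟨hcl, fun y hy => by simpa using h1 y hy⟩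
    · right; exact ⟨hcl, fun y hy => by simpa using h1 y hy⟩
  have hext0 : ∀ a ∈ (convexHull ℝ (closure (slice B S u))).extremePoints ℝ, a ≠ 0 := by
    rintro a ha rfl
    have := slice_one rfl ha.1
    simp at this
  have hbot : ∀ s, Submodule.span ℝ (D s) = ⊥ → ∀ a ∈ D s, a = 0 := by
    intro s hs a ha
    have : a ∈ Submodule.span ℝ (D s) := Submodule.subset_span ha
    rwa [hs, Submodule.mem_bot] at this
  have hV0 : Submodule.span ℝ (D 1) ≠ ⊥ := by
    intro hb
    apply h.sign_change (-1) (by norm_num)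
    intro a ha
    rcases hext a ha with h1 | h1
    · exact absurd (hbot _ hb a h1) (hext0 a ha)
    · exact h1.2
  have hV1 : Submodule.span ℝ (D (-1)) ≠ ⊥ := by
    intro hb
    apply h.sign_change 1 (by norm_num)
    intro a ha
    rcases hext a ha with h1 | h1
    · exact h1.2
    · exact absurd (hbot _ hb a h1) (hext0 a ha)
  set V₀ := Submodule.span ℝ (D 1) with hV₀
  set V₁ := Submodule.span ℝ (D (-1)) with hV₁
  have hort : ∀ v₀ ∈ V₀, ∀ v₁ ∈ V₁, B v₀ v₁ = 0 := by
    intro v₀ h0 v₁ h1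
    have s1 : ∀ a ∈ D 1, B a v₁ = 0 := by
      intro a ha
      have : V₁ ≤ LinearMap.ker (B a) := Submodule.span_le.2 fun b hb => hDort a ha b hb
      exact this h1
    have : V₀ ≤ LinearMap.ker (B v₁) := Submodule.span_le.2 fun a ha => by
      show B v₁ a = 0
      rw [h.symm]; exact s1 a ha
    rw [h.symm]
    exact this h0
  have htop : V₀ ⊔ V₁ = ⊤ := by
    apply h.span_top
    have hX : convexHull ℝ (closure (slice B S u)) ⊆ (V₀ ⊔ V₁ : Submodule ℝ E) := by
      rw [← closure_convexHull_extremePoints h.slice_compact (convex_convexHull ℝ _)]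
      refine closure_minimal (convexHull_min ?_ (Submodule.convex _))
        (Submodule.closed_of_finiteDimensional _)
      intro a ha
      rcases hext a ha with h1 | h1
      · exact (le_sup_left : V₀ ≤ V₀ ⊔ V₁) (Submodule.subset_span h1)
      · exact (le_sup_right : V₁ ≤ V₀ ⊔ V₁) (Submodule.subset_span h1)
    intro x hx
    have h1 := hX (subset_convexHull ℝ _ (subset_closure (h.mem_slice hx)))
    have h2 := (V₀ ⊔ V₁).smul_mem (B u x) h1
    rwa [smul_smul, mul_inv_cancel₀ (h.upos hx).ne', one_smul] at h2
  have hzero : ∀ v, (∀ w ∈ V₀, B v w = 0) → (∀ w ∈ V₁, B v w = 0) → v = 0 := by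
    intro v h0 h1
    apply h.nondeg
    intro w
    have hw : w ∈ V₀ ⊔ V₁ := by rw [htop]; trivial
    obtain ⟨a, ha, b, hb, rfl⟩ := Submodule.mem_sup.1 hw
    rw [map_add, h0 a ha, h1 b hb, add_zero]
  have hort' : ∀ v₁ ∈ V₁, ∀ v₀ ∈ V₀, B v₁ v₀ = 0 := fun v₁ h1 v₀ h0 => by
    rw [h.symm]; exact hort v₀ h0 v₁ h1
  have hcompl : IsCompl V₀ V₁ := by
    refine ⟨?_, codisjoint_iff.2 htop⟩
    rw [Submodule.disjoint_def]
    intro v h0 h1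
    exact hzero v (fun w hw => hort' v h1 w hw) (fun w hw => hort v h0 w hw)
  refine ⟨V₀, V₁, hV0, hV1, ?_, ?_, hcompl, hort, ?_, ?_, ?_⟩
  · intro ht
    have := hcompl.disjoint
    rw [ht, top_disjoint] at this
    exact hV1 this
  · intro ht
    have := hcompl.disjoint
    rw [ht, disjoint_top] at this
    exact hV0 this
  · intro v hv hw
    exact hzero v hw (fun w hw => hort v hv w hw)
  · intro v hv hw
    exact hzero v (fun w hw => hort' v hv w hw) hw
  · intro g hg
    have hgc : Continuous g := LinearMap.continuous_of_finiteDimensional (g : E →ₗ[ℝ] E)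
    have hD : ∀ s, ∀ a ∈ D s, g a ∈ D s := by
      intro s a ha
      refine ⟨map_mem_closure hgc ha.1 (fun v hv => (h.pres g hg v).2 hv), fun y hy => ?_⟩
      have hy' : g.symm y ∈ S := by rw [← h.pres g hg]; simpa using hy
      have e := h.isom g hg a (g.symm y)
      rw [LinearEquiv.apply_symm_apply] at e
      rw [e]
      exact ha.2 _ hy'
    have hmap : ∀ s, Submodule.map (g : E →ₗ[ℝ] E) (Submodule.span ℝ (D s)) =
        Submodule.span ℝ (D s) := by
      intro s
      apply Submodule.eq_of_le_of_finrank_eq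
      · rw [Submodule.map_span_le]
        exact fun a ha => Submodule.subset_span (hD s a ha)
      · exact LinearEquiv.finrank_map_eq g _
    exact ⟨hmap 1, hmap (-1)⟩

end GoodCone

section Geo

theorem mkv_open_iff {W : Type} [AddCommGroup W] [Module ℝ W] [TopologicalSpace W]
    {U : Set (ℙ ℝ W)} :
    IsOpen U ↔ IsOpen {v : {v : W // v ≠ 0} | Projectivization.mk ℝ v.1 v.2 ∈ U} :=
  Iff.rfl

theorem lift_open {W : Type} [NormedAddCommGroup W] [NormedSpace ℝ W]
    {U : Set (ℙ ℝ W)} (hU : IsOpen U) :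
    IsOpen {v : W | ∃ hv : v ≠ 0, Projectivization.mk ℝ v hv ∈ U} := by
  have h1 := mkv_open_iff.1 hU
  have h2 := (isOpen_ne (x := (0 : W))).isOpenMap_subtype_val _ h1
  convert h2 using 1
  ext v
  constructor
  · rintro ⟨hv, h⟩
    exact ⟨⟨v, hv⟩, h, rfl⟩
  · rintro ⟨⟨v, hv⟩, h, rfl⟩
    exact ⟨hv, h⟩

theorem rep_mk_eq {W : Type} [AddCommGroup W] [Module ℝ W] (v : W) (hv : v ≠ 0) :
    ∃ a : ℝ, a ≠ 0 ∧ (Projectivization.mk ℝ v hv).rep = a • v := by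
  obtain ⟨a, ha⟩ := Projectivization.exists_smul_eq_mk_rep ℝ v hv
  exact ⟨a, a.ne_zero, ha.symm⟩

theorem mk_smul_eq {W : Type} [AddCommGroup W] [Module ℝ W] (v : W) (hv : v ≠ 0) (a : ℝ)
    (h : a • v ≠ 0) : Projectivization.mk ℝ (a • v) h = Projectivization.mk ℝ v hv := by
  rw [Projectivization.mk_eq_mk_iff']
  exact ⟨a, rfl⟩

/-- Separating map of projective space. -/
def sepMap {m : ℕ} (x : ℙ ℝ (Fin m → ℝ)) (i j : Fin m) : ℝ :=
  x.rep i * x.rep j / ∑ k, x.rep k ^ 2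

theorem sumsq_pos {m : ℕ} {v : Fin m → ℝ} (hv : v ≠ 0) : 0 < ∑ k, v k ^ 2 := by
  obtain ⟨i, hi⟩ := Function.ne_iff.1 hv
  exact Finset.sum_pos' (fun _ _ => sq_nonneg _) ⟨i, Finset.mem_univ _, by
    have : v i ≠ 0 := hi
    positivity⟩

theorem sepMap_mk {m : ℕ} (v : Fin m → ℝ) (hv : v ≠ 0) (i j : Fin m) :
    sepMap (Projectivization.mk ℝ v hv) i j = v i * v j / ∑ k, v k ^ 2 := by
  obtain ⟨a, ha, h⟩ := rep_mk_eq v hv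
  have := sumsq_pos hv
  unfold sepMap
  rw [h]
  simp only [Pi.smul_apply, smul_eq_mul, mul_pow, ← Finset.mul_sum]
  field_simp

theorem sepMap_injective {m : ℕ} : Function.Injective (sepMap (m := m)) := by
  intro x y hxy
  induction x using Projectivization.ind with | h v hv =>
  induction y using Projectivization.ind with | h w hw =>
  have h : ∀ i j, v i * v j / ∑ k, v k ^ 2 = w i * w j / ∑ k, w k ^ 2 := by
    intro i j
    rw [← sepMap_mk v hv, ← sepMap_mk w hw, hxy]
  obtain ⟨i, hi⟩ := Function.ne_iff.1 hv
  have hi : v i ≠ 0 := hi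
  have p1 := sumsq_pos hv
  have p2 := sumsq_pos hw
  set P := ∑ k, v k ^ 2
  set R := ∑ k, w k ^ 2
  rw [Projectivization.mk_eq_mk_iff']
  refine ⟨P * w i / (R * v i), ?_⟩
  ext j
  have := h i j
  simp only [Pi.smul_apply, smul_eq_mul]
  field_simp at this ⊢
  linarith

theorem sepMap_continuous {m : ℕ} : Continuous (sepMap (m := m)) := by
  refine continuous_coinduced_dom.2 ?_
  refine continuous_pi fun i => continuous_pi fun j => ?_
  have : (fun v : {v : Fin m → ℝ // v ≠ 0} => v.1 i * v.1 j / ∑ k, v.1 k ^ 2) =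
      fun v => sepMap (Projectivization.mk ℝ v.1 v.2) i j := by
    funext v; rw [sepMap_mk]
  show Continuous (fun v : {v : Fin m → ℝ // v ≠ 0} => sepMap (Projectivization.mk ℝ v.1 v.2) i j)
  rw [← this]
  have hc : ∀ i, Continuous (fun v : {v : Fin m → ℝ // v ≠ 0} => v.1 i) :=
    fun i => (continuous_apply i).comp continuous_subtype_val
  exact Continuous.div ((hc i).mul (hc j)) (continuous_finsetSum _ fun k _ => (hc k).pow 2)
    fun v => (sumsq_pos v.2).ne'

instance proj_t2 {m : ℕ} : T2Space (ℙ ℝ (Fin m → ℝ)) :=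
  T2Space.of_injective_continuous sepMap_injective sepMap_continuous

/-- The form as a bilinear map. -/
def bLin (p q : ℕ) : (Fin (p + q + 2) → ℝ) →ₗ[ℝ] (Fin (p + q + 2) → ℝ) →ₗ[ℝ] ℝ :=
  LinearMap.mk₂ ℝ (bForm p q)
    (fun a b v => by
      simp only [bForm, Pi.add_apply, ← Finset.sum_add_distrib]
      exact Finset.sum_congr rfl fun i _ => by ring)
    (fun a b v => by simp [bForm, Finset.mul_sum]; congr 1; ext; ring)
    (fun a b v => by
      simp only [bForm, Pi.add_apply, ← Finset.sum_add_distrib]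
      exact Finset.sum_congr rfl fun i _ => by ring)
    (fun a b v => by simp [bForm, Finset.mul_sum]; congr 1; ext; ring)

theorem bLin_apply (p q : ℕ) (v w) : bLin p q v w = bForm p q v w := rfl

theorem bLin_symm (p q : ℕ) (v w) : bLin p q v w = bLin p q w v := by
  simp only [bLin_apply, bForm]; congr 1; ext; ring

theorem bLin_single (p q : ℕ) (v : Fin (p + q + 2) → ℝ) (i : Fin (p + q + 2)) (c : ℝ) :
    bLin p q v (Pi.single i c) = (if (i : ℕ) ≤ p then (-1 : ℝ) else 1) * v i * c := by
  rw [bLin_apply, bForm, Finset.sum_eq_single i]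
  · simp
  · intro j _ hj; simp [hj]
  · simp

theorem bLin_nondeg (p q : ℕ) (v : Fin (p + q + 2) → ℝ) (h : ∀ w, bLin p q v w = 0) : v = 0 := by
  ext i
  have := h (Pi.single i 1)
  rw [bLin_single] at this
  split_ifs at this <;> simpa using this

theorem bLin_two (p q : ℕ) (x : Fin (p + q + 2) → ℝ) (i j : Fin (p + q + 2)) (hij : i ≠ j) (s : ℝ)
    (hi : (if (i : ℕ) ≤ p then (-1 : ℝ) else 1) = s)
    (hj : (if (j : ℕ) ≤ p then (-1 : ℝ) else 1) = s) :
    ∃ w, ∃ r : ℝ, 0 < r ∧ bLin p q x w = 0 ∧ bLin p q w w = s * r := by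
  obtain ⟨c, d, h1, h2⟩ : ∃ c d : ℝ, c * x i + d * x j = 0 ∧ 0 < c ^ 2 + d ^ 2 := by
    by_cases h : x i = 0
    · exact ⟨1, 0, by simp [h], by norm_num⟩
    · exact ⟨x j, - x i, by ring, by
        have := pow_pos (abs_pos.2 h) 2
        rw [sq_abs] at this
        nlinarith [sq_nonneg (x j)]⟩
  refine ⟨Pi.single i c + Pi.single j d, c ^ 2 + d ^ 2, h2, ?_, ?_⟩
  · rw [map_add, bLin_single, bLin_single, hi, hj]
    linear_combination s * h1
  · rw [map_add, bLin_single, bLin_single, hi, hj]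
    simp [Pi.single_apply, hij, hij.symm]
    ring

theorem bLin_perp (p q : ℕ) (hp : 1 ≤ p) (hq : 1 ≤ q) (x : Fin (p + q + 2) → ℝ) :
    ∃ w₁ w₂, bLin p q x w₁ = 0 ∧ 0 < bLin p q w₁ w₁ ∧ bLin p q x w₂ = 0 ∧
      bLin p q w₂ w₂ < 0 := by
  obtain ⟨w₁, r, hr, a1, a2⟩ := bLin_two p q x ⟨p + 1, by omega⟩ ⟨p + 2, by omega⟩
    (by simp) 1 (by simp) (by simp)
  obtain ⟨w₂, r', hr', b1, b2⟩ := bLin_two p q x ⟨0, by omega⟩ ⟨1, by omega⟩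
    (by simp) (-1) (by simp) (by simp [hp])
  exact ⟨w₁, w₂, a1, by rw [a2]; linarith, b1, by rw [b2]; linarith⟩

theorem bLin_cont (p q : ℕ) (u : Fin (p + q + 2) → ℝ) : Continuous (bLin p q u) :=
  LinearMap.continuous_of_finiteDimensional _

theorem bLin_cont_diag (p q : ℕ) : Continuous (fun v => bLin p q v v) := by
  simp only [bLin_apply, bForm]
  fun_prop

theorem mk_mem_ein (p q : ℕ) (v : Fin (p + q + 2) → ℝ) (hv : v ≠ 0) :
    Projectivization.mk ℝ v hv ∈ einSet (bForm p q) ↔ bLin p q v v = 0 := by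
  obtain ⟨a, ha, h⟩ := rep_mk_eq v hv
  show bLin p q _ _ = 0 ↔ _
  rw [h]
  simp [ha]

theorem mk_mem_light (p q : ℕ) (x : ℙ ℝ (Fin (p + q + 2) → ℝ)) (v : Fin (p + q + 2) → ℝ)
    (hv : v ≠ 0) (h0 : bLin p q v v = 0) (h1 : bLin p q x.rep v = 0) :
    Projectivization.mk ℝ v hv ∈ lightcone (bForm p q) x := by
  refine ⟨(mk_mem_ein p q v hv).2 h0, ?_⟩
  obtain ⟨a, ha, h⟩ := rep_mk_eq v hv
  show bLin p q _ _ = 0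
  rw [h]
  simp [h1]

theorem ein_closed (p q : ℕ) : IsClosed (einSet (bForm p q)) := by
  rw [← isOpen_compl_iff, mkv_open_iff]
  have : {v : {v : Fin (p + q + 2) → ℝ // v ≠ 0} |
      Projectivization.mk ℝ v.1 v.2 ∈ (einSet (bForm p q))ᶜ} =
      {v | bLin p q v.1 v.1 ≠ 0} := by
    ext v
    exact not_congr (mk_mem_ein p q v.1 v.2)
  rw [this]
  exact isOpen_ne_fun ((bLin_cont_diag p q).comp continuous_subtype_val) continuous_const

/-- The open subset of projective space where a product of linear forms is positive. -/
theorem prod_open {m : ℕ} (f g : (Fin m → ℝ) →ₗ[ℝ] ℝ) :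
    IsOpen {x : ℙ ℝ (Fin m → ℝ) | 0 < f x.rep * g x.rep} := by
  rw [mkv_open_iff]
  have : {v : {v : Fin m → ℝ // v ≠ 0} |
      Projectivization.mk ℝ v.1 v.2 ∈ {x : ℙ ℝ (Fin m → ℝ) | 0 < f x.rep * g x.rep}} =
      {v | 0 < f v.1 * g v.1} := by
    ext v
    obtain ⟨a, ha, h⟩ := rep_mk_eq v.1 v.2
    simp only [mem_setOf_eq, h, map_smul, smul_eq_mul]
    have e : a * f v.1 * (a * g v.1) = a ^ 2 * (f v.1 * g v.1) := by ring
    rw [e]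
    exact mul_pos_iff_of_pos_left (by positivity)
  rw [this]
  have hf := LinearMap.continuous_of_finiteDimensional f
  have hg := LinearMap.continuous_of_finiteDimensional g
  exact isOpen_lt continuous_const
    ((hf.comp continuous_subtype_val).mul (hg.comp continuous_subtype_val))

end Geo

theorem exists_goodCone (p q : ℕ) (hp : 1 ≤ p) (hq : 1 ≤ q)
    (Ω : Set (ℙ ℝ (Fin (p + q + 2) → ℝ)))
    (hΩ : IsProperDomain (bForm p q) Ω)
    (hqh : IsQuasiHomogeneous (bForm p q) Ω) :
    ∃ S u c G K, GoodCone (bLin p q) S u c G K ∧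
      ∀ g ∈ Conf (bForm p q) Ω, g ∈ G ∨ g.trans (LinearEquiv.neg ℝ) ∈ G := by
  obtain ⟨⟨hΩe, hΩo, hΩc⟩, x₀, hx₀, hdisj⟩ := hΩ
  obtain ⟨K₀, hK₀, hK₀c, hcov⟩ := hqh
  set u := x₀.rep with hu
  have hbu := bLin_cont p q u
  have hcl_null : ∀ v (hv : v ≠ 0), Projectivization.mk ℝ v hv ∈ closure Ω →
      bLin p q v v = 0 := fun v hv h =>
    (mk_mem_ein p q v hv).1 (closure_minimal hΩe (ein_closed p q) h)
  have hcl_ne : ∀ v (hv : v ≠ 0), Projectivization.mk ℝ v hv ∈ closure Ω → bLin p q u v ≠ 0 := by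
    intro v hv h h0
    have : Projectivization.mk ℝ v hv ∈ closure Ω ∩ lightcone (bForm p q) x₀ :=
      ⟨h, mk_mem_light p q x₀ v hv (hcl_null v hv h) h0⟩
    rw [hdisj] at this
    exact this
  have hne : ∀ v (hv : v ≠ 0), Projectivization.mk ℝ v hv ∈ Ω → bLin p q u v ≠ 0 :=
    fun v hv h => hcl_ne v hv (subset_closure h)
  -- the bound
  obtain ⟨c, hc, hbound⟩ : ∃ c : ℝ, 0 < c ∧ ∀ v (hv : v ≠ 0),
      Projectivization.mk ℝ v hv ∈ Ω → c * ‖v‖ ≤ |bLin p q u v| := by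
    have hFc : IsCompact (Metric.sphere (0 : Fin (p + q + 2) → ℝ) 1 \
        {v | ∃ hv : v ≠ 0, Projectivization.mk ℝ v hv ∈ (closure Ω)ᶜ}) :=
      (isCompact_sphere _ _).diff (lift_open isClosed_closure.isOpen_compl)
    obtain ⟨c, hc, hmin⟩ := hFc.exists_forall_le' (f := fun v => |bLin p q u v|) (a := 0)
      hbu.abs.continuousOn (by
        rintro v ⟨hv1, hv2⟩
        have hv0 : v ≠ 0 := by rintro rfl; simp at hv1
        refine abs_pos.2 (hcl_ne v hv0 ?_)
        by_contra hn
        exact hv2 ⟨hv0, hn⟩)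
    refine ⟨c, hc, fun v hv h => ?_⟩
    have hn : 0 < ‖v‖ := norm_pos_iff.2 hv
    have hv' : ‖v‖⁻¹ • v ≠ 0 := smul_ne_zero (inv_ne_zero hn.ne') hv
    have := hmin (‖v‖⁻¹ • v) ⟨by simp [norm_smul, hn.ne'], by
      rintro ⟨h1, h2⟩
      rw [mk_smul_eq v hv] at h2
      exact h2 (subset_closure h)⟩
    rw [map_smul, smul_eq_mul, abs_mul, abs_of_pos (inv_pos.2 hn)] at this
    rw [inv_mul_eq_div, le_div_iff₀ hn] at this
    exact this
  let S : Set (Fin (p + q + 2) → ℝ) :=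
    {v | (∃ hv : v ≠ 0, Projectivization.mk ℝ v hv ∈ Ω) ∧ 0 < bLin p q u v}
  let G : Set ((Fin (p + q + 2) → ℝ) ≃ₗ[ℝ] (Fin (p + q + 2) → ℝ)) :=
    {g | (∀ v w, bLin p q (g v) (g w) = bLin p q v w) ∧ ∀ v, g v ∈ S ↔ v ∈ S}
  let K : Set (Fin (p + q + 2) → ℝ) :=
    (Metric.sphere 0 1 \ {v | ∃ hv : v ≠ 0, Projectivization.mk ℝ v hv ∈ K₀ᶜ}) ∩
      {v | 0 ≤ bLin p q u v}
  have hpre : IsPreconnected Ω := by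
    have := hΩc.isPreconnected.image Subtype.val continuous_subtype_val.continuousOn
    rwa [Subtype.image_preimage_coe, inter_eq_right.2 hΩe] at this
  have hconf : ∀ g ∈ Conf (bForm p q) Ω, g ∈ G ∨ g.trans (LinearEquiv.neg ℝ) ∈ G := by
    rintro g ⟨hg1, hg2⟩
    have hisom : ∀ v w, bLin p q (g v) (g w) = bLin p q v w := by
      intro v w
      have h1 : bLin p q (g (v + w)) (g (v + w)) = bLin p q (v + w) (v + w) := hg1 (v + w)
      have h2 : bLin p q (g v) (g v) = bLin p q v v := hg1 v
      have h3 : bLin p q (g w) (g w) = bLin p q w w := hg1 w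
      simp only [map_add, LinearMap.add_apply] at h1
      rw [bLin_symm p q (g w) (g v), bLin_symm p q w v] at h1
      linarith
    have hgne : ∀ v, v ≠ 0 → g v ≠ 0 := fun v hv => by simpa using hv
    have hmem : ∀ v (hv : v ≠ 0), Projectivization.mk ℝ (g v) (hgne v hv) ∈ Ω ↔
        Projectivization.mk ℝ v hv ∈ Ω := by
      intro v hv
      have e : projMap g (Projectivization.mk ℝ v hv) =
        Projectivization.mk ℝ (g v) (hgne v hv) := rfl
      rw [← e]
      conv_lhs => rw [← hg2]
      have hinj : Function.Injective (projMap g) := Projectivization.map_injective _ g.injective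
      exact hinj.mem_set_image
    have hmem' : ∀ v, (∃ hv : g v ≠ 0, Projectivization.mk ℝ (g v) hv ∈ Ω) ↔
        (∃ hv : v ≠ 0, Projectivization.mk ℝ v hv ∈ Ω) := by
      intro v
      constructor
      · rintro ⟨hv, h⟩
        have hv0 : v ≠ 0 := by rintro rfl; simp at hv
        exact ⟨hv0, (hmem v hv0).1 h⟩
      · rintro ⟨hv, h⟩
        exact ⟨hgne v hv, (hmem v hv).2 h⟩
    have hsign : (∀ v (hv : v ≠ 0), Projectivization.mk ℝ v hv ∈ Ω →
          0 < bLin p q u (g v) * bLin p q u v) ∨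
        (∀ v (hv : v ≠ 0), Projectivization.mk ℝ v hv ∈ Ω →
          0 < bLin p q u (-g v) * bLin p q u v) := by
      by_contra hcon
      push Not at hcon
      obtain ⟨⟨v, hv, hvΩ, h1⟩, ⟨w, hw, hwΩ, h2⟩⟩ := hcon
      have P1 := prod_open ((bLin p q u) ∘ₗ (g : _ →ₗ[ℝ] _)) (bLin p q u)
      have P2 := prod_open (-((bLin p q u) ∘ₗ (g : _ →ₗ[ℝ] _))) (bLin p q u)
      have hne0 : ∀ v (hv : v ≠ 0), Projectivization.mk ℝ v hv ∈ Ω →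
          bLin p q u (g v) * bLin p q u v ≠ 0 := fun v hv h =>
        mul_ne_zero (hne _ (hgne v hv) ((hmem v hv).2 h)) (hne v hv h)
      have hrep : ∀ v (hv : v ≠ 0), ∃ r : ℝ, 0 < r ∧
          bLin p q u (g (Projectivization.mk ℝ v hv).rep) *
            bLin p q u (Projectivization.mk ℝ v hv).rep =
          r * (bLin p q u (g v) * bLin p q u v) := by
        intro v hv
        obtain ⟨a, ha, h⟩ := rep_mk_eq v hv
        refine ⟨a ^ 2, by positivity, ?_⟩
        rw [h]
        simp only [map_smul, smul_eq_mul]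
        ring
      have hsub : Ω ⊆ {x | 0 < ((bLin p q u) ∘ₗ (g : _ →ₗ[ℝ] _)) x.rep * bLin p q u x.rep} ∪
          {x | 0 < (-((bLin p q u) ∘ₗ (g : _ →ₗ[ℝ] _))) x.rep * bLin p q u x.rep} := by
        intro x hx
        have h3 := hne0 x.rep x.rep_nonzero (by rwa [Projectivization.mk_rep])
        rcases lt_or_gt_of_ne h3 with h4 | h4
        · right
          simp only [mem_setOf_eq, LinearMap.neg_apply, LinearMap.comp_apply,
            LinearEquiv.coe_coe, neg_mul]
          linarith
        · left; exact h4
      obtain ⟨x, hx, hx1, hx2⟩ := hpre _ _ P1 P2 hsub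
        ⟨_, hwΩ, by
          obtain ⟨r, hr, e⟩ := hrep w hw
          simp only [mem_setOf_eq, LinearMap.comp_apply, LinearEquiv.coe_coe]
          rw [e]
          have := hne0 w hw hwΩ
          rw [map_neg, neg_mul] at h2
          exact mul_pos hr (lt_of_le_of_ne (by linarith) this.symm)⟩
        ⟨_, hvΩ, by
          obtain ⟨r, hr, e⟩ := hrep v hv
          simp only [mem_setOf_eq, LinearMap.neg_apply, LinearMap.comp_apply,
            LinearEquiv.coe_coe, neg_mul]
          rw [e, ← mul_neg]
          have := hne0 v hv hvΩ
          exact mul_pos hr (neg_pos.2 (lt_of_le_of_ne h1 this))⟩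
      simp only [mem_setOf_eq, LinearMap.neg_apply, neg_mul] at hx1 hx2
      linarith
    rcases hsign with hs | hs
    · left
      refine ⟨hisom, fun v => ?_⟩
      show (_ ∧ _) ↔ (_ ∧ _)
      rw [hmem' v]
      refine and_congr_right ?_
      rintro ⟨hv, h⟩
      exact (pos_iff_pos_of_mul_pos (hs v hv h))
    · right
      refine ⟨fun v w => ?_, fun v => ?_⟩
      · simp [hisom]
      · show (_ ∧ _) ↔ (_ ∧ _)
        have e : (g.trans (LinearEquiv.neg ℝ)) v = - g v := rfl
        have hneg : (∃ hv : - g v ≠ 0, Projectivization.mk ℝ (- g v) hv ∈ Ω) ↔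
            (∃ hv : g v ≠ 0, Projectivization.mk ℝ (g v) hv ∈ Ω) := by
          have e2 : ∀ (h1 : g v ≠ 0) (h2 : - g v ≠ 0), Projectivization.mk ℝ (- g v) h2 =
              Projectivization.mk ℝ (g v) h1 := by
            intro h1 h2
            rw [Projectivization.mk_eq_mk_iff']
            exact ⟨-1, by simp⟩
          constructor
          · rintro ⟨h2, h⟩
            have h1 : g v ≠ 0 := by simpa using h2
            exact ⟨h1, by rwa [← e2 h1 h2]⟩
          · rintro ⟨h1, h⟩
            have h2 : - g v ≠ 0 := by simpa using h1
            exact ⟨h2, by rwa [e2 h1 h2]⟩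
        rw [e, hneg, hmem' v]
        refine and_congr_right ?_
        rintro ⟨hv, h⟩
        exact (pos_iff_pos_of_mul_pos (hs v hv h))
  have hKS : ∀ v ∈ K, (∃ hv : v ≠ 0, Projectivization.mk ℝ v hv ∈ K₀) ∧ v ∈ S := by
    rintro v ⟨⟨h1, h2⟩, h3⟩
    have hv0 : v ≠ 0 := by rintro rfl; simp at h1
    have hvK : Projectivization.mk ℝ v hv0 ∈ K₀ := by
      by_contra hn
      exact h2 ⟨hv0, hn⟩
    exact ⟨⟨hv0, hvK⟩, ⟨hv0, hK₀ hvK⟩, lt_of_le_of_ne h3 (hne v hv0 (hK₀ hvK)).symm⟩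
  have hSsmul : ∀ t : ℝ, 0 < t → ∀ v ∈ S, t • v ∈ S := by
    rintro t ht v ⟨⟨hv, h⟩, h1⟩
    have hv' : t • v ≠ 0 := smul_ne_zero ht.ne' hv
    refine ⟨⟨hv', by rwa [mk_smul_eq v hv]⟩, ?_⟩
    rw [map_smul]
    exact mul_pos ht h1
  -- every point of `Ω` has a unit lift in `S`
  have hlift : ∀ x ∈ Ω, ∃ v, ∃ hv : v ≠ 0, ‖v‖ = 1 ∧ Projectivization.mk ℝ v hv = x ∧
      0 < bLin p q u v := by
    intro x hx
    have hr := x.rep_nonzero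
    have hn : 0 < ‖x.rep‖ := norm_pos_iff.2 hr
    have hb := hne x.rep hr (by rwa [Projectivization.mk_rep])
    rcases lt_or_gt_of_ne hb with h | h
    · have h' : (-‖x.rep‖⁻¹) • x.rep ≠ 0 := smul_ne_zero (by simpa using hr) hr
      refine ⟨(-‖x.rep‖⁻¹) • x.rep, h', ?_, ?_, ?_⟩
      · simp [norm_smul, hn.ne']
      · rw [mk_smul_eq _ hr, Projectivization.mk_rep]
      · rw [map_smul, smul_eq_mul]
        exact mul_pos_of_neg_of_neg (by simpa using hr) h
    · have h' : (‖x.rep‖⁻¹) • x.rep ≠ 0 := smul_ne_zero (by simpa using hr) hr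
      refine ⟨(‖x.rep‖⁻¹) • x.rep, h', ?_, ?_, ?_⟩
      · simp [norm_smul, hn.ne']
      · rw [mk_smul_eq _ hr, Projectivization.mk_rep]
      · rw [map_smul, smul_eq_mul]
        exact mul_pos (inv_pos.2 hn) h
  refine ⟨S, u, c, G, K, ?_, hconf⟩
  refine
    { symm := bLin_symm p q
      nondeg := bLin_nondeg p q
      perp := bLin_perp p q hp hq
      nonempty := ?_
      smul := hSsmul
      relopen := ?_
      null := fun v hv => hcl_null v hv.1.1 (subset_closure hv.1.2)
      unull := hx₀
      cpos := hc
      bound := fun v hv => by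
        have := hbound v hv.1.1 hv.1.2
        rwa [abs_of_pos hv.2] at this
      ne_zero := fun v hv => hv.1.1
      isom := fun g hg => hg.1
      pres := fun g hg => hg.2
      compact := ?_
      sub := fun v hv => (hKS v hv).2
      cover := ?_ }
  · obtain ⟨⟨x, _⟩, hx⟩ := hΩc.nonempty
    have hx : x ∈ Ω := hx
    obtain ⟨v, hv, -, h1, h2⟩ := hlift x hx
    exact ⟨v, ⟨hv, by rwa [h1]⟩, h2⟩
  · rintro x ⟨⟨hx, hxΩ⟩, hxu⟩
    obtain ⟨U, hU, hUΩ⟩ := isOpen_induced_iff.1 hΩo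
    have hUiff : ∀ y ∈ einSet (bForm p q), y ∈ U ↔ y ∈ Ω := by
      intro y hy
      have := Set.ext_iff.1 hUΩ ⟨y, hy⟩
      exact this
    have h1 : ∀ᶠ y in 𝓝 x, ∃ hv : y ≠ 0, Projectivization.mk ℝ y hv ∈ U :=
      (lift_open hU).mem_nhds ⟨hx, (hUiff _ (hΩe hxΩ)).2 hxΩ⟩
    have h2 : ∀ᶠ y in 𝓝 x, 0 < bLin p q u y := hbu.continuousAt.eventually (lt_mem_nhds hxu)
    filter_upwards [h1, h2] with y hy1 hy2 hy0
    obtain ⟨hy, hyU⟩ := hy1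
    exact ⟨⟨hy, (hUiff _ ((mk_mem_ein p q y hy).2 hy0)).1 hyU⟩, hy2⟩
  · exact ((isCompact_sphere _ _).diff (lift_open hK₀c.isClosed.isOpen_compl)).inter_right
      (isClosed_le continuous_const hbu)
  · intro y hy
    obtain ⟨hy0, hyΩ0⟩ := hy.1
    have hyΩ := (Set.ext_iff.1 hcov (Projectivization.mk ℝ y hy0)).1 hyΩ0
    simp only [mem_iUnion] at hyΩ
    obtain ⟨g, hg, z, hz, hgz⟩ := hyΩ
    obtain ⟨v, hv, hv1, hvz, hvu⟩ := hlift z (hK₀ hz)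
    have hvK : v ∈ K := by
      refine ⟨⟨by simpa using hv1, ?_⟩, hvu.le⟩
      rintro ⟨hv', h⟩
      rw [hvz] at h
      exact h hz
    have hgne : g v ≠ 0 := by simpa using hv
    have e : projMap g z = Projectivization.mk ℝ (g v) hgne := by rw [← hvz]; rfl
    rw [e] at hgz
    obtain ⟨a, ha⟩ := (Projectivization.mk_eq_mk_iff' ℝ _ _ _ _).1 hgz.symm
    have hyu := hy.2
    have fin : ∀ (k : (Fin (p + q + 2) → ℝ) ≃ₗ[ℝ] (Fin (p + q + 2) → ℝ)) (b : ℝ), k ∈ G →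
        b • k v = y → ∃ g ∈ G, ∃ x ∈ K, ∃ t : ℝ, 0 < t ∧ y = t • g x := by
      intro k b hk hb
      have h1 : 0 < bLin p q u (k v) := ((hk.2 v).2 (hKS v hvK).2).2
      refine ⟨k, hk, v, hvK, b, ?_, hb.symm⟩
      rw [← hb, map_smul, smul_eq_mul] at hyu
      exact (pos_iff_pos_of_mul_pos hyu).2 h1
    rcases hconf g hg with h | h
    · exact fin _ a h ha
    · refine fin _ (-a) h ?_
      rw [← ha]
      simp

/-- The conformal group of a proper quasi-homogeneous domain preserves
a nontrivial orthogonal direct sum decomposition of `ℝⁿ` into nondegenerate subspaces. -/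
theorem stmt_19 (p q : ℕ) (hp : 1 ≤ p) (hq : 1 ≤ q)
    (Ω : Set (ℙ ℝ (Fin (p + q + 2) → ℝ)))
    (hΩ : IsProperDomain (bForm p q) Ω)
    (hqh : IsQuasiHomogeneous (bForm p q) Ω) :
    ∃ V₀ V₁ : Submodule ℝ (Fin (p + q + 2) → ℝ),
      V₀ ≠ ⊥ ∧ V₁ ≠ ⊥ ∧ V₀ ≠ ⊤ ∧ V₁ ≠ ⊤ ∧
      IsCompl V₀ V₁ ∧
      (∀ v₀ ∈ V₀, ∀ v₁ ∈ V₁, bForm p q v₀ v₁ = 0) ∧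
      (∀ v ∈ V₀, (∀ w ∈ V₀, bForm p q v w = 0) → v = 0) ∧
      (∀ v ∈ V₁, (∀ w ∈ V₁, bForm p q v w = 0) → v = 0) ∧
      ∀ g ∈ Conf (bForm p q) Ω,
        Submodule.map (g : (Fin (p + q + 2) → ℝ) →ₗ[ℝ] (Fin (p + q + 2) → ℝ)) V₀ = V₀ ∧
        Submodule.map (g : (Fin (p + q + 2) → ℝ) →ₗ[ℝ] (Fin (p + q + 2) → ℝ)) V₁ = V₁ := by
  obtain ⟨S, u, c, G, K, hgood, hG⟩ := exists_goodCone p q hp hq Ω hΩ hqh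
  obtain ⟨V₀, V₁, h1, h2, h3, h4, h5, h6, h7, h8, h9⟩ := hgood.main
  refine ⟨V₀, V₁, h1, h2, h3, h4, h5, h6, h7, h8, fun g hg => ?_⟩
  rcases hG g hg with h | h
  · exact h9 g h
  · have key : ∀ V : Submodule ℝ (Fin (p + q + 2) → ℝ),
        Submodule.map ((g.trans (LinearEquiv.neg ℝ) : _ ≃ₗ[ℝ] _) : _ →ₗ[ℝ] _) V =
          Submodule.map (g : (Fin (p + q + 2) → ℝ) →ₗ[ℝ] (Fin (p + q + 2) → ℝ)) V := by
      intro V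
      ext y
      simp only [Submodule.mem_map]
      constructor
      · rintro ⟨x, hx, rfl⟩
        exact ⟨-x, V.neg_mem hx, by simp⟩
      · rintro ⟨x, hx, rfl⟩
        exact ⟨-x, V.neg_mem hx, by simp⟩
    have := h9 _ h
    rwa [key, key] at this
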